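/- Let G be obtained from C_n □ K_2 by applying TF-inflations at vertices of exactly two distinct pillars that do not belong to a common quadrangle of the prism. Then G is hamiltonian if and only if n is even, and for odd n, G has a hamiltonian path. -/

import Mathlib

open SimpleGraph

/-- Vertex type of the `n`-prism `C_n □ K_2`: the base cycle consists of the
vertices `(i, false)` (the `sᵢ`) and the top cycle of the vertices `(i, true)` (the `tᵢ`). -/
abbrev PV (n : ℕ) := ZMod n × Bool

/-- The prism graph `C_n □ K_2`. -/
def prismG (n : ℕ) : SimpleGraph (PV n) :=
  SimpleGraph.fromRel fun u v =>
    (u.1 = v.1 ∧ u.2 ≠ v.2) ∨ (u.2 = v.2 ∧ v.1 = u.1 + 1)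

/-- The pillar edge `sᵢtᵢ`. -/
def pillar (n : ℕ) (i : ZMod n) : Sym2 (PV n) :=
  s(((i, false) : PV n), ((i, true) : PV n))

/-- The base-cycle edge `sᵢs_{i+1}`. -/
def baseEdge (n : ℕ) (i : ZMod n) : Sym2 (PV n) :=
  s(((i, false) : PV n), ((i + 1, false) : PV n))

/-- The top-cycle edge `tᵢt_{i+1}`. -/
def topEdge (n : ℕ) (i : ZMod n) : Sym2 (PV n) :=
  s(((i, true) : PV n), ((i + 1, true) : PV n))

def IsPillar {n : ℕ} (e : Sym2 (PV n)) : Prop := ∃ i, e = pillar n i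
def IsBaseEdge {n : ℕ} (e : Sym2 (PV n)) : Prop := ∃ i, e = baseEdge n i
def IsTopEdge {n : ℕ} (e : Sym2 (PV n)) : Prop := ∃ i, e = topEdge n i

/-- A hamiltonian cycle of the prism is *meandering* if no two of its edges lying on the
top cycle or on the base cycle are adjacent (share a vertex; in a cycle, edges sharing a
vertex are exactly the consecutive ones). -/
def Meandering {n : ℕ} {v : PV n} (C : (prismG n).Walk v v) : Prop :=
  ∀ e ∈ C.edges, ∀ f ∈ C.edges, e ≠ f →
    ((IsBaseEdge e ∧ IsBaseEdge f) ∨ (IsTopEdge e ∧ IsTopEdge f)) → ¬ ∃ x, x ∈ e ∧ x ∈ f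

/-- Explicit edge list of the Tutte Fragment on 15 vertices, following Tutte (1946):
`0 = a`, `1 = b` (the two bottom corner 2-valent vertices), `2 = c` (the apex 2-valent
vertex); `3, …, 14` are the internal 3-valent vertices `p₁, …, p₁₂`. -/
def TFedges : List (Fin 15 × Fin 15) :=
  [(0,4),(4,5),(5,6),(6,2),(1,7),(7,8),(8,2),(0,14),(14,1),(4,9),(9,3),(3,10),(10,7),
   (5,11),(11,12),(6,13),(13,8),(13,12),(12,10),(11,9),(3,14)]

/-- The Tutte Fragment as a simple graph on `Fin 15`. -/
def TF : SimpleGraph (Fin 15) :=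
  SimpleGraph.fromRel fun x y => (x, y) ∈ TFedges

/-- The attachment port of the prism vertex `u` used for the former prism edge towards the
neighbour `w`, after the TF-inflations prescribed by the set `S` of inflated vertices and the
orientation choice `orient`.  A non-inflated vertex keeps its single representative (port `0`);
for an inflated vertex the vertex `c = 2` of its Tutte Fragment is incident with the pillar,
and the vertices `a = 0`, `b = 1` are attached to the two cycle neighbours according to
`orient u`. -/
def port {n : ℕ} (S : Finset (PV n)) (orient : PV n → Bool) (u w : PV n) : Fin 15 :=
  if u ∉ S then 0
  else if u.1 = w.1 then 2
  else if w.1 = u.1 + 1 then (if orient u then 0 else 1)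
  else (if orient u then 1 else 0)

/-- Vertex type of the TF-inflated prism: an inflated prism vertex `v ∈ S` is replaced by the
15 vertices `(v, k)` of a fresh copy of the Tutte Fragment, while a non-inflated vertex `v`
is represented by `(v, 0)` alone. -/
def InflV (n : ℕ) (S : Finset (PV n)) := {x : PV n × Fin 15 // x.1 ∈ S ∨ x.2 = 0}

/-- The graph obtained from the prism `C_n □ K_2` by TF-inflating every vertex in `S`
(with orientations `orient`, and with the `c`-vertex of each fragment incident to the
corresponding pillar). -/
def inflPrism (n : ℕ) (S : Finset (PV n)) (orient : PV n → Bool) :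
    SimpleGraph (InflV n S) :=
  SimpleGraph.fromRel fun x y =>
    (x.val.1 = y.val.1 ∧ x.val.1 ∈ S ∧ TF.Adj x.val.2 y.val.2) ∨
    (x.val.1 ≠ y.val.1 ∧ (prismG n).Adj x.val.1 y.val.1 ∧
      x.val.2 = port S orient x.val.1 y.val.1 ∧
      y.val.2 = port S orient y.val.1 x.val.1)

/-- The vertex of the inflated prism representing the attachment port of the prism vertex `u`
towards its prism neighbour `w`. -/
def liftV {n : ℕ} (S : Finset (PV n)) (orient : PV n → Bool) (u w : PV n) :
    InflV n S :=
  ⟨(u, port S orient u w), by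
    by_cases h : u ∈ S
    · exact Or.inl h
    · exact Or.inr (by simp [port, h])⟩

/-- The set of (indices of) pillars of the prism carrying at least one TF-inflated vertex. -/
def inflatedPillars {n : ℕ} (S : Finset (PV n)) : Set (ZMod n) :=
  {i : ZMod n | ((i, false) : PV n) ∈ S ∨ ((i, true) : PV n) ∈ S}

instance (n : ℕ) (S : Finset (PV n)) : DecidableEq (InflV n S) := by
  unfold InflV; infer_instance



/-! ### Finite analysis of the fragment -/

instance tfDec : DecidableRel TF.Adj := fun x y => by
  unfold TF; simp only [SimpleGraph.fromRel_adj]; infer_instance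

set_option maxHeartbeats 4000000 in
theorem tf_linear (a04 a45 a56 a62 a17 a78 a82 aE eb a49 a93 a3A aA7 a5B aBC a6D aD8 aDC aCA aB9 a3E
    x0 x1 x2 : ℕ)
    (l04 : a04 ≤ 1) (l45 : a45 ≤ 1) (l56 : a56 ≤ 1) (l62 : a62 ≤ 1) (l17 : a17 ≤ 1)
    (l78 : a78 ≤ 1) (l82 : a82 ≤ 1) (_laE : aE ≤ 1) (leb : eb ≤ 1) (l49 : a49 ≤ 1)
    (l93 : a93 ≤ 1) (_l3A : a3A ≤ 1) (lA7 : aA7 ≤ 1) (l5B : a5B ≤ 1) (lBC : aBC ≤ 1)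
    (l6D : a6D ≤ 1) (lD8 : aD8 ≤ 1) (lDC : aDC ≤ 1) (_lCA : aCA ≤ 1) (lB9 : aB9 ≤ 1)
    (l3E : a3E ≤ 1) (lx0 : x0 ≤ 1) (lx1 : x1 ≤ 1) (lx2 : x2 ≤ 1)
    (d0 : a04 + aE + x0 = 2) (d1 : a17 + eb + x1 = 2) (d2 : a62 + a82 + x2 = 2)
    (d3 : a93 + a3A + a3E = 2) (d4 : a04 + a45 + a49 = 2) (d5 : a45 + a56 + a5B = 2)
    (d6 : a56 + a62 + a6D = 2) (d7 : a17 + a78 + aA7 = 2) (d8 : a78 + a82 + aD8 = 2)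
    (d9 : a49 + a93 + aB9 = 2) (dA : a3A + aA7 + aCA = 2) (dB : a5B + aBC + aB9 = 2)
    (dC : aBC + aDC + aCA = 2) (dD : a6D + aD8 + aDC = 2) (dE : aE + eb + a3E = 2)
    (z0 : 1 ≤ x0 + x1 + x2)
    (z1 : 1 ≤ a04 + a17 + a3E + x2)
    (z2 : 1 ≤ a56 + a78 + aDC + x2)
    (z3 : 1 ≤ a04 + a56 + a93 + aBC)
    (z4 : 1 ≤ a04 + a93 + aCA + a78 + x2)
    (z5 : 1 ≤ a56 + aBC + a3A + a17 + x2) :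
    x0 + x1 + x2 = 2 ∧ x2 = 1 := by
  have hs : x0 + x1 + x2 + 2 * (a04 + a45 + a56 + a62 + a17 + a78 + a82 + aE + eb + a49 + a93 + a3A +
      aA7 + a5B + aBC + a6D + aD8 + aDC + aCA + aB9 + a3E) = 30 := by
    linarith
  have h : x0 + x1 + x2 = 2 := by
    clear * - hs lx0 lx1 lx2 z0
    omega
  refine ⟨h, ?_⟩
  by_contra hx
  obtain rfl : x2 = 0 := by omega
  obtain rfl : x0 = 1 := by omega
  obtain rfl : x1 = 1 := by omega
  obtain rfl : a62 = 1 := by omega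
  obtain rfl : a82 = 1 := by omega
  clear z0 h hx
  have c04 : a04 = 0 ∨ a04 = 1 := by clear * - l04; omega
  have c17 : a17 = 0 ∨ a17 = 1 := by clear * - l17; omega
  have c93 : a93 = 0 ∨ a93 = 1 := by clear * - l93; omega
  have c56 : a56 = 0 ∨ a56 = 1 := by clear * - l56; omega
  have c78 : a78 = 0 ∨ a78 = 1 := by clear * - l78; omega
  have eE : aE = 1 - a04 := by clear * - d0 l04; omega
  have eb' : eb = 1 - a17 := by clear * - d1 l17; omega
  have e3E : a3E = 2 - aE - eb := by clear * - dE; omega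
  have e3A : a3A = 2 - a93 - a3E := by clear * - d3; omega
  have e6D : a6D = 1 - a56 := by clear * - d6; omega
  have eD8 : aD8 = 1 - a78 := by clear * - d8; omega
  have eA7 : aA7 = 2 - a17 - a78 := by clear * - d7; omega
  have eDC : aDC = 2 - a6D - aD8 := by clear * - dD; omega
  have eCA : aCA = 2 - a3A - aA7 := by clear * - dA; omega
  have eBC : aBC = 2 - aDC - aCA := by clear * - dC; omega
  rcases c04 with rfl | rfl <;> rcases c17 with rfl | rfl <;> rcases c93 with rfl | rfl <;>
    rcases c56 with rfl | rfl <;> rcases c78 with rfl | rfl <;>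
    simp only [Nat.reduceSub, Nat.sub_zero, Nat.sub_self] at eE eb' e3E e3A e6D eD8 eA7 eDC eCA eBC <;>
    subst eE eb' <;>
    simp only [Nat.reduceSub, Nat.sub_zero, Nat.sub_self] at e3E e6D eD8 eA7 <;>
    subst e3E e6D eD8 eA7 <;>
    simp only [Nat.reduceSub, Nat.sub_zero, Nat.sub_self] at e3A eDC <;>
    subst e3A eDC <;>
    simp only [Nat.reduceSub, Nat.sub_zero, Nat.sub_self] at eCA <;>
    subst eCA <;>
    simp only [Nat.reduceSub, Nat.sub_zero, Nat.sub_self] at eBC <;>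
    subst eBC <;> omega

/-! ### ZMod analysis -/

theorem zmod_all {n : ℕ} [NeZero n] (D : ZMod n → Prop) (k0 : ZMod n) (h0 : D k0)
    (hs : ∀ k, D k → D (k + 1)) (k : ZMod n) : D k := by
  have : ∀ m : ℕ, D (k0 + m) := by
    intro m
    induction m with
    | zero => simpa using h0
    | succ m ih => simpa [add_assoc] using hs _ ih
  have h := this (k - k0).val
  simpa using h

theorem zmod_core {n : ℕ} [NeZero n] (b t P : ZMod n → ℕ) (i j : ZMod n) (hij : i ≠ j)
    (h1 : j ≠ i + 1) (h2 : i ≠ j + 1)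
    (lb : ∀ k, b k ≤ 1) (lt : ∀ k, t k ≤ 1) (lP : ∀ k, P k ≤ 1)
    (hb : ∀ k, b (k + 1) + b k + P (k + 1) = 2) (ht : ∀ k, t (k + 1) + t k + P (k + 1) = 2)
    (hi : P i = 1) (hj : P j = 1)
    (hc : ∀ g g', g ≠ g' → b g = 0 → t g = 0 → b g' = 0 → t g' = 0 → False) : Even n := by
  by_cases hP : ∀ k, P k = 1
  · have : ∀ m : ℕ, b (m : ZMod n) = if Even m then b 0 else 1 - b 0 := by
      intro m
      induction m with
      | zero => simp
      | succ m ih =>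
        have e1 := hb m
        have e2 := hP (m + 1)
        have e3 := lb 0
        push_cast
        by_cases hm : Even m
        · have : ¬ Even (m + 1) := by simpa [Nat.even_add_one] using hm
          simp only [hm, this, if_true, if_false] at ih ⊢
          omega
        · have : Even (m + 1) := by simpa [Nat.even_add_one] using hm
          simp only [hm, this, if_true, if_false] at ih ⊢
          omega
    have h := this n
    by_contra hne
    simp only [hne, if_false, ZMod.natCast_self] at h
    have := lb 0
    omega
  · exfalso
    push Not at hP
    obtain ⟨k0, hk0⟩ := hP
    have hD : ∀ k, b k = t k := by
      apply zmod_all (fun k => b k = t k) k0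
      · have e1 := hb (k0 - 1)
        have e2 := ht (k0 - 1)
        simp only [sub_add_cancel] at e1 e2
        have := lb k0; have := lt k0; have := lb (k0 - 1); have := lt (k0 - 1); have := lP k0
        omega
      · intro k hk
        have e1 := hb k
        have e2 := ht k
        omega
    have gap : ∀ k, P k = 1 → ∃ g, (g = k ∨ g = k - 1) ∧ b g = 0 := by
      intro k hk
      have e1 := hb (k - 1)
      simp only [sub_add_cancel] at e1
      by_cases h : b k = 0
      · exact ⟨k, Or.inl rfl, h⟩
      · exact ⟨k - 1, Or.inr rfl, by have := lb k; omega⟩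
    obtain ⟨g, hg, bg⟩ := gap i hi
    obtain ⟨g', hg', bg'⟩ := gap j hj
    refine hc g g' ?_ bg (by rw [← hD, bg]) bg' (by rw [← hD, bg'])
    rintro rfl
    rcases hg with rfl | rfl <;> rcases hg' with h | h
    · exact hij h
    · exact h1 (by rw [h]; ring)
    · exact h2 (by rw [← h]; ring)
    · exact hij (by simpa using h)

/-! ### General facts on Hamiltonian cycles -/

section ham
variable {V : Type*} {G : SimpleGraph V}

theorem walk_closed {u v : V} (p : G.Walk u v) (Z : V → Prop)
    (hZ : ∀ a b, s(a, b) ∈ p.edges → (Z a ↔ Z b)) : ∀ x ∈ p.support, (Z x ↔ Z u) := by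
  induction p with
  | nil => intro x hx; simp at hx; simp [hx]
  | cons h p ih =>
    intro x hx
    rw [SimpleGraph.Walk.support_cons, List.mem_cons] at hx
    rcases hx with rfl | hx
    · rfl
    · have e := ih (fun a b hab => hZ a b (by simp [hab])) x hx
      rw [e]
      exact (hZ _ _ (by simp)).symm

theorem cubic_deg [DecidableEq V] {u : V} (C : G.Walk u u) (hC : C.IsHamiltonianCycle)
    (x y1 y2 y3 : V) (h12 : y1 ≠ y2) (h13 : y1 ≠ y3) (h23 : y2 ≠ y3)
    (hN : ∀ y, G.Adj x y → y = y1 ∨ y = y2 ∨ y = y3) :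
    (if s(x, y1) ∈ C.edges then 1 else 0) + (if s(x, y2) ∈ C.edges then 1 else 0) +
      (if s(x, y3) ∈ C.edges then 1 else 0) = 2 := by
  have h2 := hC.isCycle.ncard_neighborSet_toSubgraph_eq_two (hC.mem_support x)
  have hs : C.toSubgraph.neighborSet x =
      (({y1, y2, y3} : Finset V).filter (fun y => s(x, y) ∈ C.edges) : Finset V) := by
    ext y
    simp only [SimpleGraph.Subgraph.mem_neighborSet, SimpleGraph.Walk.adj_toSubgraph_iff_mem_edges,
      Finset.coe_filter, Finset.mem_insert, Finset.mem_singleton, Set.mem_ofPred_eq]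
    exact ⟨fun h => ⟨hN y (C.adj_of_mem_edges h), h⟩, fun h => h.2⟩
  rw [hs, Set.ncard_coe_finset, Finset.card_filter, Finset.sum_insert (by simp [h12, h13]),
    Finset.sum_insert (by simp [h23]), Finset.sum_singleton] at h2
  omega

end ham

/-! ### Adjacency in the inflated prism -/

theorem prism_adj_iff {n : ℕ} (hn : 3 ≤ n) (u w : PV n) :
    (prismG n).Adj u w ↔
      w = (u.1, !u.2) ∨ w = (u.1 + 1, u.2) ∨ w = (u.1 - 1, u.2) := by
  have : Fact (1 < n) := ⟨by omega⟩
  have h10 : (1 : ZMod n) ≠ 0 := one_ne_zero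
  obtain ⟨a, p⟩ := u
  obtain ⟨c, q⟩ := w
  simp only [prismG, SimpleGraph.fromRel_adj, Prod.mk.injEq, ne_eq]
  constructor
  · rintro ⟨hne, (⟨h, h'⟩ | ⟨h, h'⟩) | (⟨h, h'⟩ | ⟨h, h'⟩)⟩
    · left; refine ⟨h.symm, ?_⟩; cases p <;> cases q <;> simp_all
    · right; left; exact ⟨h', h.symm⟩
    · left; refine ⟨h, ?_⟩; cases p <;> cases q <;> simp_all
    · right; right; exact ⟨by rw [h']; ring, h⟩
  · rintro (⟨rfl, rfl⟩ | ⟨rfl, rfl⟩ | ⟨rfl, rfl⟩)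
    · simp
    · simp [h10]
    · have : a ≠ a - 1 := fun h => h10 (by linear_combination h)
      simp [this]

theorem two_ne_zero_zmod {n : ℕ} (hn : 3 ≤ n) : (2 : ZMod n) ≠ 0 := by
  intro h
  have : ((2 : ℕ) : ZMod n) = 0 := by exact_mod_cast h
  rw [ZMod.natCast_eq_zero_iff] at this
  exact absurd (Nat.le_of_dvd (by norm_num) this) (by omega)

theorem add_one_ne {n : ℕ} (hn : 3 ≤ n) (k : ZMod n) : k + 1 ≠ k := by
  have : Fact (1 < n) := ⟨by omega⟩
  simp

theorem sub_one_ne {n : ℕ} (hn : 3 ≤ n) (k : ZMod n) : k - 1 ≠ k := by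
  have : Fact (1 < n) := ⟨by omega⟩
  simp

theorem sub_one_ne_add_one {n : ℕ} (hn : 3 ≤ n) (k : ZMod n) : k - 1 ≠ k + 1 := by
  intro h
  apply two_ne_zero_zmod hn
  linear_combination -h

theorem not_ne_self (b : Bool) : (!b) ≠ b := by cases b <;> simp

section infl
variable {n : ℕ} {S : Finset (PV n)} {orient : PV n → Bool}

theorem infl_ext {x y : InflV n S} (h1 : x.val.1 = y.val.1) (h2 : x.val.2 = y.val.2) : x = y :=
  Subtype.ext (Prod.ext h1 h2)

theorem eq_lift_iff (x : InflV n S) (w : PV n) :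
    x = liftV S orient x.val.1 w ↔ x.val.2 = port S orient x.val.1 w :=
  ⟨fun h => congrArg (fun z : InflV n S => z.val.2) h, fun h => infl_ext rfl h⟩

theorem infl_adj_iff (x y : InflV n S) :
    (inflPrism n S orient).Adj x y ↔
      (x.val.1 = y.val.1 ∧ x.val.1 ∈ S ∧ TF.Adj x.val.2 y.val.2) ∨
      ((prismG n).Adj x.val.1 y.val.1 ∧ x = liftV S orient x.val.1 y.val.1 ∧
        y = liftV S orient y.val.1 x.val.1) := by
  rw [eq_lift_iff, eq_lift_iff]
  unfold inflPrism
  rw [SimpleGraph.fromRel_adj]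
  constructor
  · rintro ⟨hne, (⟨h1, h2, h3⟩ | ⟨h1, h2, h3, h4⟩) | (⟨h1, h2, h3⟩ | ⟨h1, h2, h3, h4⟩)⟩
    · exact Or.inl ⟨h1, h2, h3⟩
    · exact Or.inr ⟨h2, h3, h4⟩
    · exact Or.inl ⟨h1.symm, h1 ▸ h2, h3.symm⟩
    · exact Or.inr ⟨h2.symm, h4, h3⟩
  · rintro (⟨h1, h2, h3⟩ | ⟨h2, h3, h4⟩)
    · refine ⟨?_, Or.inl (Or.inl ⟨h1, h2, h3⟩)⟩
      intro he
      exact h3.ne (by rw [he])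
    · refine ⟨?_, Or.inl (Or.inr ⟨h2.ne, h2, h3, h4⟩)⟩
      intro he
      exact h2.ne (by rw [he])

theorem lift_adj {u w : PV n} (h : (prismG n).Adj u w) :
    (inflPrism n S orient).Adj (liftV S orient u w) (liftV S orient w u) := by
  rw [infl_adj_iff]
  exact Or.inr ⟨h, rfl, rfl⟩

/-- the vertex `k` of the fragment at `u`. -/
def fv {u : PV n} (hu : u ∈ S) (k : Fin 15) : InflV n S := ⟨(u, k), Or.inl hu⟩

theorem fv_inj {u : PV n} (hu : u ∈ S) {k l : Fin 15} (h : fv hu k = fv hu l) : k = l :=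
  congrArg (fun z : InflV n S => z.val.2) h

theorem lift_eq_fv {u : PV n} (hu : u ∈ S) (w : PV n) :
    liftV S orient u w = fv hu (port S orient u w) := rfl

theorem port_P {u : PV n} (hu : u ∈ S) (b : Bool) : port S orient u (u.1, b) = 2 := by
  simp [port, hu]

theorem port_R (hn : 3 ≤ n) {u : PV n} (hu : u ∈ S) (b : Bool) :
    port S orient u (u.1 + 1, b) = if orient u then 0 else 1 := by
  have := (add_one_ne hn u.1).symm
  simp [port, hu, this]

theorem port_L (hn : 3 ≤ n) {u : PV n} (hu : u ∈ S) (b : Bool) :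
    port S orient u (u.1 - 1, b) = if orient u then 1 else 0 := by
  have h1 := (sub_one_ne hn u.1).symm
  have h2 := (sub_one_ne_add_one hn u.1)
  simp only [port, hu, not_true, if_false, h1, h2]

section cyc
variable {x0 : InflV n S} (C : (inflPrism n S orient).Walk x0 x0)

/-- indicator of an edge in the cycle -/
def ind (x y : InflV n S) : ℕ := if s(x, y) ∈ C.edges then 1 else 0

theorem ind_le (x y : InflV n S) : ind C x y ≤ 1 := by unfold ind; split <;> simp

theorem ind_symm (x y : InflV n S) : ind C x y = ind C y x := by unfold ind; rw [Sym2.eq_swap]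

/-- indicator of a prism edge in the cycle -/
def EE (u w : PV n) : ℕ := ind C (liftV S orient u w) (liftV S orient w u)

theorem EE_symm (u w : PV n) : EE C u w = EE C w u := ind_symm C _ _

theorem closed_lem (hC : C.IsHamiltonianCycle) (Z : InflV n S → Prop)
    (hZ : ∀ a b, Z a → ¬ Z b → (inflPrism n S orient).Adj a b → ind C a b = 0) (a b : InflV n S)
    (ha : Z a) (hb : ¬ Z b) : False := by
  have h := walk_closed C Z (by
    intro a b hab
    have hadj := C.adj_of_mem_edges hab
    constructor
    · intro h; by_contra h'
      have := hZ a b h h' hadj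
      simp [ind, hab] at this
    · intro h; by_contra h'
      have := hZ b a h h' hadj.symm
      rw [ind_symm] at this
      simp [ind, hab] at this)
  have h1 := h a (hC.mem_support a)
  have h2 := h b (hC.mem_support b)
  tauto

theorem deg_non (hn : 3 ≤ n) (hC : C.IsHamiltonianCycle) (u : PV n) (hu : u ∉ S) :
    EE C u (u.1 + 1, u.2) + EE C u (u.1 - 1, u.2) + EE C u (u.1, !u.2) = 2 := by
  have e : ∀ w w', liftV S orient u w = liftV S orient u w' := by
    intro w w'
    refine infl_ext (by rfl) ?_
    simp [liftV, port, hu]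
  have key : ∀ w w', w ≠ w' → liftV S orient w u ≠ liftV S orient w' u := by
    intro w w' h h'
    exact h (congrArg (fun z : InflV n S => z.val.1) h')
  have h := cubic_deg C hC (liftV S orient u (u.1 + 1, u.2))
    (liftV S orient (u.1 + 1, u.2) u) (liftV S orient (u.1 - 1, u.2) u)
    (liftV S orient (u.1, !u.2) u)
    (key _ _ (by simpa using (sub_one_ne_add_one hn u.1).symm))
    (key _ _ (by simp [add_one_ne hn])) (key _ _ (by simp [sub_one_ne hn])) (by
      intro y hy
      rw [infl_adj_iff] at hy
      rcases hy with ⟨_, h2, _⟩ | ⟨h1, _, h3⟩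
      · exact absurd h2 hu
      · change (prismG n).Adj u y.val.1 at h1
        change y = liftV S orient y.val.1 u at h3
        rw [h3]
        rcases (prism_adj_iff hn _ _).1 h1 with h | h | h <;> rw [h] <;> simp)
  unfold EE ind
  rw [e (u.1 - 1, u.2) (u.1 + 1, u.2), e (u.1, !u.2) (u.1 + 1, u.2)]
  exact h

theorem deg_int (hn : 3 ≤ n) (hC : C.IsHamiltonianCycle) {u : PV n} (hu : u ∈ S)
    (k a b c : Fin 15) (hk : k ≠ 0 ∧ k ≠ 1 ∧ k ≠ 2) (hN : ∀ l, TF.Adj k l → l = a ∨ l = b ∨ l = c)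
    (hd : a ≠ b ∧ a ≠ c ∧ b ≠ c) :
    ind C (fv hu k) (fv hu a) + ind C (fv hu k) (fv hu b) + ind C (fv hu k) (fv hu c) = 2 := by
  refine cubic_deg C hC _ _ _ _ (fun h => hd.1 (fv_inj hu h)) (fun h => hd.2.1 (fv_inj hu h))
    (fun h => hd.2.2 (fv_inj hu h)) ?_
  intro y hy
  rw [infl_adj_iff] at hy
  rcases hy with ⟨h1, _, h3⟩ | ⟨h1, h2, _⟩
  · have hy' : y = fv hu y.val.2 := by
      apply Subtype.ext
      exact Prod.ext h1.symm rfl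
    rw [hy']
    rcases hN _ h3 with h | h | h <;> rw [h] <;> simp
  · exfalso
    have h2' : k = port S orient u y.val.1 := fv_inj hu h2
    change (prismG n).Adj u y.val.1 at h1
    rcases (prism_adj_iff hn _ _).1 h1 with h | h | h
    · rw [h, port_P hu] at h2'; exact hk.2.2 h2'
    · rw [h, port_R hn hu] at h2'; split at h2'
      · exact hk.1 h2'
      · exact hk.2.1 h2'
    · rw [h, port_L hn hu] at h2'; split at h2'
      · exact hk.2.1 h2'
      · exact hk.1 h2'

theorem deg_ext (hC : C.IsHamiltonianCycle) {u : PV n} (hu : u ∈ S)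
    (k a b : Fin 15) (w : PV n) (huw : (prismG n).Adj u w) (hk : port S orient u w = k)
    (huniq : ∀ w', (prismG n).Adj u w' → port S orient u w' = k → w' = w)
    (hN : ∀ l, TF.Adj k l → l = a ∨ l = b)
    (hd : a ≠ b) :
    ind C (fv hu k) (fv hu a) + ind C (fv hu k) (fv hu b) + EE C u w = 2 := by
  unfold EE
  rw [lift_eq_fv hu, hk]
  have key : ∀ l, fv hu l ≠ liftV S orient w u := fun l h =>
    huw.ne (congrArg (fun z : InflV n S => z.val.1) h)
  refine cubic_deg C hC _ _ _ _ (fun h => hd (fv_inj hu h)) (key _) (key _) ?_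
  intro y hy
  rw [infl_adj_iff] at hy
  rcases hy with ⟨h1, _, h3⟩ | ⟨h1, h2, h3⟩
  · have hy' : y = fv hu y.val.2 := by
      apply Subtype.ext
      exact Prod.ext h1.symm rfl
    rw [hy']
    rcases hN _ h3 with h | h <;> rw [h] <;> simp
  · have h2' : k = port S orient u y.val.1 := fv_inj hu h2
    have := huniq _ h1 h2'.symm
    right; right
    rw [h3, this]
    rfl

/-- A set `Z` of fragment vertices is left by the cycle. -/
theorem frag_cut (hC : C.IsHamiltonianCycle) {u : PV n} (hu : u ∈ S) (Z : Fin 15 → Bool)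
    (k0 : Fin 15) (hk0 : Z k0 = true) (v : InflV n S) (hv : v.val.1 ≠ u)
    (hint : ∀ k l, Z k = true → Z l = false → TF.Adj k l → ind C (fv hu k) (fv hu l) = 0)
    (hext : ∀ w, (prismG n).Adj u w → Z (port S orient u w) = true → EE C u w = 0) : False := by
  refine closed_lem C hC (fun x => x.val.1 = u ∧ Z x.val.2 = true) ?_ (fv hu k0) v ⟨rfl, hk0⟩
    (fun h => hv h.1)
  rintro x y ⟨ha1, ha2⟩ hb hadj
  have hx : x = fv hu x.val.2 := infl_ext ha1 rfl
  rw [infl_adj_iff] at hadj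
  rcases hadj with ⟨h1, _, h3⟩ | ⟨h1, h2, h3⟩
  · have hy' : y = fv hu y.val.2 := infl_ext (h1.symm.trans ha1) rfl
    have hZ : Z y.val.2 = false := by
      by_contra h
      exact hb ⟨h1.symm.trans ha1, by simpa using h⟩
    rw [hx, hy']
    exact hint _ _ ha2 hZ h3
  · rw [ha1] at h1 h2 h3
    have h2' : x.val.2 = port S orient u y.val.1 :=
      congrArg (fun z : InflV n S => z.val.2) h2
    have := hext _ h1 (by rw [← h2']; exact ha2)
    unfold EE at this
    rw [← h3, ← h2] at this
    exact this

end cyc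
end infl

section infl2
variable {n : ℕ} {S : Finset (PV n)} {orient : PV n → Bool}
variable {x0 : InflV n S} (C : (inflPrism n S orient).Walk x0 x0)

theorem EE_le (u w : PV n) : EE C u w ≤ 1 := ind_le C _ _

/-- membership test for a list of fragment vertices -/
def zs (l : List (Fin 15)) : Fin 15 → Bool := fun k => decide (k ∈ l)

theorem zs_int {u : PV n} (hu : u ∈ S) (Z : List (Fin 15)) (B : List (Fin 15 × Fin 15))
    (hB : ∀ k l, zs Z k = true → zs Z l = false → TF.Adj k l → (k, l) ∈ B)
    (h0 : ∀ p ∈ B, ind C (fv hu p.1) (fv hu p.2) = 0) :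
    ∀ k l, zs Z k = true → zs Z l = false → TF.Adj k l → ind C (fv hu k) (fv hu l) = 0 :=
  fun k l h1 h2 h3 => h0 _ (hB k l h1 h2 h3)

set_option maxRecDepth 20000 in
theorem frag_main (hn : 3 ≤ n) (hC : C.IsHamiltonianCycle) {u : PV n} (hu : u ∈ S)
    (A B : PV n) (hA : (prismG n).Adj u A) (hBa : (prismG n).Adj u B)
    (pA : port S orient u A = 0) (pB : port S orient u B = 1)
    (hall : ∀ w, (prismG n).Adj u w → w = A ∨ w = B ∨ w = (u.1, !u.2)) :
    EE C u A + EE C u B + EE C u (u.1, !u.2) = 2 ∧ EE C u (u.1, !u.2) = 1 := by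
  have hPa : (prismG n).Adj u (u.1, !u.2) := (prism_adj_iff hn _ _).2 (Or.inl rfl)
  have pP : port S orient u (u.1, !u.2) = 2 := port_P hu _
  have hv : (liftV S orient (u.1, !u.2) u).val.1 ≠ u := fun h => hPa.ne h.symm
  have f := ind_symm C
  have D0 := deg_ext C hC hu 0 4 14 A hA pA
    (by intro w hw h; rcases hall w hw with rfl | rfl | rfl
        · rfl
        · rw [pB] at h; exact absurd h (by decide)
        · rw [pP] at h; exact absurd h (by decide)) (by decide) (by decide)
  have D1 := deg_ext C hC hu 1 7 14 B hBa pB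
    (by intro w hw h; rcases hall w hw with rfl | rfl | rfl
        · rw [pA] at h; exact absurd h (by decide)
        · rfl
        · rw [pP] at h; exact absurd h (by decide)) (by decide) (by decide)
  have D2 := deg_ext C hC hu 2 6 8 (u.1, !u.2) hPa pP
    (by intro w hw h; rcases hall w hw with rfl | rfl | rfl
        · rw [pA] at h; exact absurd h (by decide)
        · rw [pB] at h; exact absurd h (by decide)
        · rfl) (by decide) (by decide)
  have D3 := deg_int C hn hC hu 3 9 10 14 (by decide) (by decide) (by decide)
  have D4 := deg_int C hn hC hu 4 0 5 9 (by decide) (by decide) (by decide)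
  have D5 := deg_int C hn hC hu 5 4 6 11 (by decide) (by decide) (by decide)
  have D6 := deg_int C hn hC hu 6 5 2 13 (by decide) (by decide) (by decide)
  have D7 := deg_int C hn hC hu 7 1 8 10 (by decide) (by decide) (by decide)
  have D8 := deg_int C hn hC hu 8 7 2 13 (by decide) (by decide) (by decide)
  have D9 := deg_int C hn hC hu 9 4 3 11 (by decide) (by decide) (by decide)
  have D10 := deg_int C hn hC hu 10 3 7 12 (by decide) (by decide) (by decide)
  have D11 := deg_int C hn hC hu 11 5 12 9 (by decide) (by decide) (by decide)
  have D12 := deg_int C hn hC hu 12 11 13 10 (by decide) (by decide) (by decide)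
  have D13 := deg_int C hn hC hu 13 6 8 12 (by decide) (by decide) (by decide)
  have D14 := deg_int C hn hC hu 14 0 1 3 (by decide) (by decide) (by decide)
  have hZ : ∀ (Z : List (Fin 15)) (k0 : Fin 15) (Bd : List (Fin 15 × Fin 15)), zs Z k0 = true →
      (∀ k l, zs Z k = true → zs Z l = false → TF.Adj k l → (k, l) ∈ Bd) →
      (∀ p ∈ Bd, ind C (fv hu p.1) (fv hu p.2) = 0) →
      (zs Z 0 = true → EE C u A = 0) → (zs Z 1 = true → EE C u B = 0) →
      (zs Z 2 = true → EE C u (u.1, !u.2) = 0) → False := by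
    intro Z k0 Bd hk hB h0 hzA hzB hzP
    refine frag_cut C hC hu (zs Z) k0 hk _ hv (zs_int C hu Z Bd hB h0) ?_
    intro w hw h
    rcases hall w hw with rfl | rfl | rfl
    · exact hzA (by rwa [pA] at h)
    · exact hzB (by rwa [pB] at h)
    · exact hzP (by rwa [pP] at h)
  have z0 : 1 ≤ EE C u A + EE C u B + EE C u (u.1, !u.2) := by
    by_contra hz
    exact hZ [0,1,2,3,4,5,6,7,8,9,10,11,12,13,14] 0 [] (by decide) (by decide) (by simp)
      (by omega) (by omega) (by omega)
  have z1 : 1 ≤ ind C (fv hu 4) (fv hu 0) + ind C (fv hu 7) (fv hu 1) + ind C (fv hu 3) (fv hu 14) +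
      EE C u (u.1, !u.2) := by
    by_contra hz
    exact hZ [2,3,4,5,6,7,8,9,10,11,12,13] 2 [(4,0),(7,1),(3,14)] (by decide) (by decide)
      (by simp; omega) (fun h => absurd h (by decide)) (fun h => absurd h (by decide)) (by omega)
  have z2 : 1 ≤ ind C (fv hu 6) (fv hu 5) + ind C (fv hu 8) (fv hu 7) + ind C (fv hu 13) (fv hu 12) +
      EE C u (u.1, !u.2) := by
    by_contra hz
    exact hZ [2,6,8,13] 2 [(6,5),(8,7),(13,12)] (by decide) (by decide)
      (by simp; omega) (fun h => absurd h (by decide)) (fun h => absurd h (by decide)) (by omega)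
  have z3 : 1 ≤ ind C (fv hu 4) (fv hu 0) + ind C (fv hu 5) (fv hu 6) + ind C (fv hu 9) (fv hu 3) +
      ind C (fv hu 11) (fv hu 12) := by
    by_contra hz
    exact hZ [4,5,9,11] 4 [(4,0),(5,6),(9,3),(11,12)] (by decide) (by decide)
      (by simp; omega) (fun h => absurd h (by decide)) (fun h => absurd h (by decide))
      (fun h => absurd h (by decide))
  have z4 : 1 ≤ ind C (fv hu 4) (fv hu 0) + ind C (fv hu 9) (fv hu 3) + ind C (fv hu 12) (fv hu 10) +
      ind C (fv hu 8) (fv hu 7) + EE C u (u.1, !u.2) := by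
    by_contra hz
    exact hZ [2,4,5,6,8,9,11,12,13] 2 [(4,0),(9,3),(12,10),(8,7)] (by decide) (by decide)
      (by simp; omega) (fun h => absurd h (by decide)) (fun h => absurd h (by decide)) (by omega)
  have z5 : 1 ≤ ind C (fv hu 6) (fv hu 5) + ind C (fv hu 12) (fv hu 11) + ind C (fv hu 10) (fv hu 3) +
      ind C (fv hu 7) (fv hu 1) + EE C u (u.1, !u.2) := by
    by_contra hz
    exact hZ [2,6,7,8,10,12,13] 2 [(6,5),(12,11),(10,3),(7,1)] (by decide) (by decide)
      (by simp; omega) (fun h => absurd h (by decide)) (fun h => absurd h (by decide)) (by omega)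
  rw [f (fv hu 3) (fv hu 9)] at D3
  rw [f (fv hu 4) (fv hu 0)] at D4 z1 z3 z4
  rw [f (fv hu 5) (fv hu 4)] at D5
  rw [f (fv hu 6) (fv hu 5)] at D6 z2 z5
  rw [f (fv hu 7) (fv hu 1), f (fv hu 7) (fv hu 10)] at D7
  rw [f (fv hu 7) (fv hu 1)] at z1 z5
  rw [f (fv hu 8) (fv hu 7), f (fv hu 8) (fv hu 13)] at D8
  rw [f (fv hu 8) (fv hu 7)] at z2 z4
  rw [f (fv hu 9) (fv hu 4), f (fv hu 9) (fv hu 11)] at D9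
  rw [f (fv hu 10) (fv hu 3), f (fv hu 10) (fv hu 12)] at D10
  rw [f (fv hu 10) (fv hu 3)] at z5
  rw [f (fv hu 11) (fv hu 5)] at D11
  rw [f (fv hu 12) (fv hu 11), f (fv hu 12) (fv hu 13)] at D12
  rw [f (fv hu 12) (fv hu 11)] at z5
  rw [f (fv hu 13) (fv hu 6)] at D13
  rw [f (fv hu 14) (fv hu 0), f (fv hu 14) (fv hu 3)] at D14
  rw [f (fv hu 1) (fv hu 14)] at D1
  rw [f (fv hu 2) (fv hu 6), f (fv hu 2) (fv hu 8)] at D2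
  exact tf_linear _ _ _ _ _ _ _ _ _ _ _ _ _ _ _ _ _ _ _ _ _ _ _ _
    (ind_le C _ _) (ind_le C _ _) (ind_le C _ _) (ind_le C _ _) (ind_le C _ _) (ind_le C _ _)
    (ind_le C _ _) (ind_le C _ _) (ind_le C _ _) (ind_le C _ _) (ind_le C _ _) (ind_le C _ _)
    (ind_le C _ _) (ind_le C _ _) (ind_le C _ _) (ind_le C _ _) (ind_le C _ _) (ind_le C _ _)
    (ind_le C _ _) (ind_le C _ _) (ind_le C _ _) (EE_le C _ _) (EE_le C _ _) (EE_le C _ _)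
    D0 D1 D2 D3 D4 D5 D6 D7 D8 D9 D10 D11 D12 D13 D14 z0 z1 z2 z3 z4 z5

theorem frag_deg (hn : 3 ≤ n) (hC : C.IsHamiltonianCycle) {u : PV n} (hu : u ∈ S) :
    EE C u (u.1 + 1, u.2) + EE C u (u.1 - 1, u.2) + EE C u (u.1, !u.2) = 2 ∧
      EE C u (u.1, !u.2) = 1 := by
  have hR : (prismG n).Adj u (u.1 + 1, u.2) := (prism_adj_iff hn _ _).2 (by simp)
  have hL : (prismG n).Adj u (u.1 - 1, u.2) := (prism_adj_iff hn _ _).2 (by simp)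
  have pR := port_R (orient := orient) hn hu u.2
  have pL := port_L (orient := orient) hn hu u.2
  cases ho : orient u
  · simp only [ho] at pR pL
    have h := frag_main C hn hC hu _ _ hL hR (by simpa using pL) (by simpa using pR) (by
      intro w hw
      rcases (prism_adj_iff hn _ _).1 hw with h | h | h <;> simp [h])
    omega
  · simp only [ho] at pR pL
    have h := frag_main C hn hC hu _ _ hR hL (by simpa using pR) (by simpa using pL) (by
      intro w hw
      rcases (prism_adj_iff hn _ _).1 hw with h | h | h <;> simp [h])
    omega

theorem all_deg (hn : 3 ≤ n) (hC : C.IsHamiltonianCycle) (u : PV n) :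
    EE C u (u.1 + 1, u.2) + EE C u (u.1 - 1, u.2) + EE C u (u.1, !u.2) = 2 := by
  by_cases hu : u ∈ S
  · exact (frag_deg C hn hC hu).1
  · exact deg_non C hn hC u hu

theorem gap_false (hn : 3 ≤ n) (hC : C.IsHamiltonianCycle) (g g' : ZMod n) (hg : g ≠ g')
    (h0 : ∀ s, EE C (g, s) (g + 1, s) = 0) (h0' : ∀ s, EE C (g', s) (g' + 1, s) = 0) : False := by
  have : NeZero n := ⟨by omega⟩
  have : Fact (1 < n) := ⟨by omega⟩
  set d := (g' - g).val with hd
  have hdn : d < n := ZMod.val_lt _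
  have hgd : g' = g + d := by rw [hd]; simp
  have hd0 : 0 < d := by
    rw [Nat.pos_iff_ne_zero, hd, ne_eq, ZMod.val_eq_zero, sub_eq_zero]
    exact hg.symm
  have hval : ∀ k : ZMod n, k ≠ -1 → (k + 1).val = k.val + 1 := by
    intro k hk
    have h1 : k.val < n := ZMod.val_lt k
    have h1n := ZMod.val_one n
    rw [ZMod.val_add_of_lt, h1n]
    rw [h1n]
    rcases Nat.lt_or_ge k.val (n - 1) with h | h
    · omega
    · exfalso
      apply hk
      have : k.val + 1 = n := by omega
      have h2 : ((k.val + 1 : ℕ) : ZMod n) = 0 := by rw [this]; simp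
      push_cast at h2
      rw [ZMod.natCast_zmod_val] at h2
      exact eq_neg_of_add_eq_zero_left h2
  let q : ZMod n → ℕ := fun k => (k - g - 1).val
  have hq1 : ∀ k, k ≠ g → q (k + 1) = q k + 1 := by
    intro k hk
    have := hval (k - g - 1) (by
      intro h; apply hk; linear_combination h)
    change (k + 1 - g - 1).val = (k - g - 1).val + 1
    rw [← this]; congr 1; ring
  have hqg' : q g' = d - 1 := by
    change (g' - g - 1).val = d - 1
    have := hval (g' - g - 1) (by intro h; apply hg; linear_combination -h)
    rw [sub_add_cancel] at this
    omega
  have hqg1 : q (g + 1) = 0 := by simp [q]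
  have hqinj : ∀ k k', q k = q k' → k = k' := by
    intro k k' h
    have := ZMod.val_injective n h
    linear_combination this
  have hqg : ¬ q g < d := by
    have h1 : q g = (-1 : ZMod n).val := by simp [q]
    obtain ⟨m, rfl⟩ : ∃ m, n = m + 1 := ⟨n - 1, by omega⟩
    rw [h1, ZMod.val_neg_one]
    omega
  -- key crossing facts
  have cross : ∀ k s, (q k < d ↔ q (k + 1) < d) ∨ EE C (k, s) (k + 1, s) = 0 := by
    intro k s
    by_cases hk : k = g
    · subst hk; right; exact h0 s
    by_cases hk' : k = g'
    · subst hk'; right; exact h0' s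
    left
    have e := hq1 k hk
    have : q k ≠ d - 1 := fun h => hk' (hqinj _ _ (h.trans hqg'.symm))
    omega
  refine closed_lem C hC (fun x => q x.val.1.1 < d) ?_
    (liftV S orient (g + 1, false) (g, false)) (liftV S orient (g, false) (g, false)) ?_ ?_
  · intro a b ha hb hadj
    rw [infl_adj_iff] at hadj
    rcases hadj with ⟨h1, _, _⟩ | ⟨h1, h2, h3⟩
    · rw [h1] at ha; exact absurd ha hb
    · rw [h2, h3]
      change EE C a.val.1 b.val.1 = 0
      generalize a.val.1 = u at *
      generalize b.val.1 = w at *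
      rcases (prism_adj_iff hn _ _).1 h1 with h | h | h
      · subst h; exact absurd ha hb
      · subst h
        rcases cross u.1 u.2 with h | h
        · exact absurd (h.1 ha) hb
        · exact h
      · subst h
        rcases cross (u.1 - 1) u.2 with h | h
        · rw [sub_add_cancel] at h
          exact absurd (h.2 ha) hb
        · rw [sub_add_cancel] at h
          rw [EE_symm]; exact h
  · change q (g + 1) < d
    omega
  · exact hqg

theorem ham_even (hn : 3 ≤ n) (hC : C.IsHamiltonianCycle)
    (i j : ZMod n) (hij : i ≠ j) (h1 : j ≠ i + 1) (h2 : i ≠ j + 1)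
    (hpil : inflatedPillars S = {i, j}) : Even n := by
  have : NeZero n := ⟨by omega⟩
  have hside : ∀ s k, EE C (k + 1, s) (k + 1 + 1, s) + EE C (k, s) (k + 1, s) +
      EE C (k + 1, false) (k + 1, true) = 2 := by
    intro s k
    have h := all_deg C hn hC (k + 1, s)
    simp only [add_sub_cancel_right] at h
    rw [EE_symm C (k + 1, s) (k, s)] at h
    cases s
    · exact h
    · rw [EE_symm C (k + 1, true) (k + 1, !true)] at h
      exact h
  have hp : ∀ k, k ∈ inflatedPillars S → EE C (k, false) (k, true) = 1 := by
    rintro k (h | h)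
    · exact (frag_deg C hn hC h).2
    · rw [EE_symm]; exact (frag_deg C hn hC h).2
  refine zmod_core (fun k => EE C (k, false) (k + 1, false)) (fun k => EE C (k, true) (k + 1, true))
    (fun k => EE C (k, false) (k, true)) i j hij h1 h2 (fun k => EE_le C _ _) (fun k => EE_le C _ _)
    (fun k => EE_le C _ _) (hside false) (hside true) (hp i (by simp [hpil])) (hp j (by simp [hpil])) ?_
  intro g g' hg b1 b2 b3 b4
  exact gap_false C hn hC g g' hg (by intro s; cases s; exacts [b1, b2])
    (by intro s; cases s; exacts [b3, b4])

end infl2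

/-! ### Construction of Hamiltonian paths and cycles -/

section constr
variable {n : ℕ} {S : Finset (PV n)} {orient : PV n → Bool}

/-- `l` is a path list covering exactly the vertices satisfying `Z`, from `x` to `y`. -/
structure PL (G : SimpleGraph (InflV n S)) (Z : InflV n S → Prop) (x y : InflV n S)
    (l : List (InflV n S)) : Prop where
  chain : l.IsChain G.Adj
  nodup : l.Nodup
  mem : ∀ z, z ∈ l ↔ Z z
  head : l.head? = some x
  last : l.getLast? = some y

theorem PL.rev {G : SimpleGraph (InflV n S)} {Z : InflV n S → Prop} {x y : InflV n S}
    {l : List (InflV n S)} (h : PL G Z x y l) : PL G Z y x l.reverse where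
  chain := by
    rw [List.isChain_reverse]
    exact h.chain.imp (fun a b hab => hab.symm)
  nodup := List.nodup_reverse.2 h.nodup
  mem := by simpa using h.mem
  head := by simpa using h.last
  last := by simpa using h.head

theorem PL.app {G : SimpleGraph (InflV n S)} {Z Z' : InflV n S → Prop} {x y x' y' : InflV n S}
    {l l' : List (InflV n S)} (h : PL G Z x y l) (h' : PL G Z' x' y' l') (hadj : G.Adj y x')
    (hd : ∀ z, Z z → ¬ Z' z) : PL G (fun z => Z z ∨ Z' z) x y' (l ++ l') where
  chain := by
    rw [List.isChain_append]
    refine ⟨h.chain, h'.chain, ?_⟩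
    intro a ha b hb
    rw [h.last] at ha
    rw [h'.head] at hb
    simp only [Option.mem_def, Option.some.injEq] at ha hb
    rw [← ha, ← hb]; exact hadj
  nodup := by
    rw [List.nodup_append]
    refine ⟨h.nodup, h'.nodup, ?_⟩
    rintro a ha b hb rfl
    exact hd _ ((h.mem _).1 ha) ((h'.mem _).1 hb)
  mem := by intro z; rw [List.mem_append, h.mem, h'.mem]
  head := by simp [h.head]
  last := by simp [h'.last]

theorem frag_list {u : PV n} (hu : u ∈ S) (a b : Fin 15) (pl : List (Fin 15))
    (hc : pl.IsChain TF.Adj) (hnd : pl.Nodup) (hm : ∀ k, k ∈ pl) (hh : pl.head? = some a)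
    (hl : pl.getLast? = some b) :
    PL (inflPrism n S orient) (fun z => z.val.1 = u) (fv hu a) (fv hu b) (pl.map (fv hu)) where
  chain := by
    rw [List.isChain_map]
    refine hc.imp (fun k l h => ?_)
    rw [infl_adj_iff]
    exact Or.inl ⟨rfl, hu, h⟩
  nodup := hnd.map (fun k l h => fv_inj hu h)
  mem := by
    intro z
    rw [List.mem_map]
    constructor
    · rintro ⟨k, _, rfl⟩; rfl
    · intro h; exact ⟨z.val.2, hm _, infl_ext h.symm rfl⟩
  head := by simp [hh]
  last := by simp [hl]

theorem frag_path (hn : 3 ≤ n) (u w : PV n) (hw : w = (u.1 + 1, u.2) ∨ w = (u.1 - 1, u.2)) :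
    ∃ l, PL (inflPrism n S orient) (fun z => z.val.1 = u) (liftV S orient u w)
      (liftV S orient u (u.1, !u.2)) l := by
  by_cases hu : u ∈ S
  · rw [lift_eq_fv hu, lift_eq_fv hu, port_P hu]
    have hp : port S orient u w = 0 ∨ port S orient u w = 1 := by
      rcases hw with rfl | rfl
      · rw [port_R hn hu]; split <;> simp
      · rw [port_L hn hu]; split <;> simp
    rcases hp with h | h <;> rw [h]
    · exact ⟨_, frag_list hu 0 2 [0,4,9,3,14,1,7,10,12,11,5,6,13,8,2] (by decide) (by decide)
        (by decide) rfl rfl⟩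
    · exact ⟨_, frag_list hu 1 2 [1,14,0,4,9,3,10,7,8,13,12,11,5,6,2] (by decide) (by decide)
        (by decide) rfl rfl⟩
  · have e : liftV S orient u (u.1, !u.2) = liftV S orient u w := by
      refine infl_ext (by rfl) ?_
      simp [liftV, port, hu]
    rw [e]
    refine ⟨[liftV S orient u w], by simp, by simp, ?_, rfl, rfl⟩
    intro z
    rw [List.mem_singleton]
    constructor
    · rintro rfl; rfl
    · intro h
      refine infl_ext h ?_
      rcases z.property with h' | h'
      · exact absurd (h ▸ h') hu
      · rw [h']; simp [liftV, port, hu]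

/-- entering side at pillar `m` -/
def sd (m : ℕ) : Bool := decide (m % 2 = 1)

theorem sd_succ (m : ℕ) : sd (m + 1) = !sd m := by
  unfold sd
  rcases Nat.mod_two_eq_zero_or_one m with h | h
  · have : (m + 1) % 2 = 1 := by omega
    simp [h, this]
  · have : (m + 1) % 2 = 0 := by omega
    simp [h, this]

theorem pillar_path (hn : 3 ≤ n) (k : ZMod n) (s : Bool) :
    ∃ l, PL (inflPrism n S orient) (fun z => z.val.1.1 = k) (liftV S orient (k, s) (k - 1, s))
      (liftV S orient (k, !s) (k + 1, !s)) l := by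
  obtain ⟨l1, h1⟩ := frag_path (S := S) (orient := orient) hn (k, s) (k - 1, s) (Or.inr rfl)
  obtain ⟨l2, h2⟩ := frag_path (S := S) (orient := orient) hn (k, !s) (k + 1, !s) (Or.inl rfl)
  have h := h1.app h2.rev (by
    have := lift_adj (S := S) (orient := orient) (u := (k, s)) (w := (k, !s))
      ((prism_adj_iff hn _ _).2 (Or.inl rfl))
    simpa using this) (by
      intro z hz hz'
      rw [hz] at hz'
      simp at hz')
  refine ⟨_, h.chain, h.nodup, ?_, h.head, h.last⟩
  intro z
  rw [h.mem]
  constructor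
  · rintro (h | h) <;> rw [h]
  · intro hk
    by_cases hs : z.val.1.2 = s
    · left; exact Prod.ext hk hs
    · right; refine Prod.ext hk ?_
      simp only
      cases s <;> simpa using hs

theorem zig (hn : 3 ≤ n) (m : ℕ) (hm : m < n) :
    ∃ l, PL (inflPrism n S orient) (fun z => z.val.1.1.val ≤ m)
      (liftV S orient (0, false) (-1, false))
      (liftV S orient (m, sd (m + 1)) (m + 1, sd (m + 1))) l := by
  have : NeZero n := ⟨by omega⟩
  induction m with
  | zero =>
    obtain ⟨l, h⟩ := pillar_path (S := S) (orient := orient) hn 0 false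
    refine ⟨l, h.chain, h.nodup, ?_, by simpa using h.head, by simpa [sd] using h.last⟩
    intro z
    rw [h.mem, Nat.le_zero, ZMod.val_eq_zero]
  | succ m ih =>
    obtain ⟨l, h⟩ := ih (by omega)
    obtain ⟨l', h'⟩ := pillar_path (S := S) (orient := orient) hn ((m + 1 : ℕ) : ZMod n) (sd (m + 1))
    have hval : ((m + 1 : ℕ) : ZMod n).val = m + 1 := ZMod.val_cast_of_lt hm
    have key : ∀ z : ZMod n, z = ((m + 1 : ℕ) : ZMod n) ↔ z.val = m + 1 := by
      intro z
      constructor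
      · rintro rfl; exact hval
      · intro hz; apply ZMod.val_injective n; rw [hz, hval]
    have ha := h.app h' (by
      have := lift_adj (S := S) (orient := orient) (u := ((m : ZMod n), sd (m + 1)))
        (w := ((m : ZMod n) + 1, sd (m + 1))) ((prism_adj_iff hn _ _).2 (Or.inr (Or.inl rfl)))
      simpa using this) (by
        intro z hz hz'
        rw [key] at hz'
        omega)
    refine ⟨_, ha.chain, ha.nodup, ?_, ha.head, ?_⟩
    · intro z
      rw [ha.mem, key]
      omega
    · rw [ha.last, sd_succ (m + 1)]

theorem zig_full (hn : 3 ≤ n) :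
    ∃ l, PL (inflPrism n S orient) (fun _ => True)
      (liftV S orient (0, false) (-1, false))
      (liftV S orient (-1, sd n) (0, sd n)) l := by
  have : NeZero n := ⟨by omega⟩
  obtain ⟨m, rfl⟩ : ∃ m, n = m + 1 := ⟨n - 1, by omega⟩
  obtain ⟨l, h⟩ := zig (S := S) (orient := orient) hn m (by omega)
  have h0 : (m : ZMod (m + 1)) + 1 = 0 := by
    have := ZMod.natCast_self (m + 1)
    push_cast at this
    exact this
  have h1 : (m : ZMod (m + 1)) = -1 := eq_neg_of_add_eq_zero_left h0
  refine ⟨l, h.chain, h.nodup, ?_, h.head, ?_⟩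
  · intro z
    rw [h.mem]
    have := ZMod.val_lt z.val.1.1
    simp only [iff_true]
    omega
  · rw [h.last, h0, h1]

theorem walk_of_PL {G : SimpleGraph (InflV n S)} {x y : InflV n S} {l : List (InflV n S)}
    (h : PL G (fun _ => True) x y l) : ∃ p : G.Walk x y, p.IsHamiltonian := by
  have hne : l ≠ [] := by
    rintro rfl
    simpa using h.head
  have hx : l.head hne = x := by
    have := h.head
    rw [List.head?_eq_some_head hne] at this
    simpa using this
  have hy : l.getLast hne = y := by
    have := h.last
    rw [List.getLast?_eq_some_getLast hne] at this
    simpa using this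
  subst hx hy
  refine ⟨SimpleGraph.Walk.ofSupport l hne h.chain, ?_⟩
  intro a
  rw [SimpleGraph.Walk.support_ofSupport]
  exact List.count_eq_one_of_mem h.nodup ((h.mem a).2 trivial)

theorem cycle_of_path {V : Type*} [DecidableEq V] {G : SimpleGraph V} {x y z : V} (p : G.Walk x y)
    (hp : p.IsHamiltonian) (hadj : G.Adj y x) (hzx : z ≠ x) (hzy : z ≠ y) :
    (SimpleGraph.Walk.cons hadj p).IsHamiltonianCycle := by
  rw [SimpleGraph.Walk.isHamiltonianCycle_iff_isCycle_and_support_count_tail_eq_one]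
  refine ⟨?_, ?_⟩
  · rw [SimpleGraph.Walk.cons_isCycle_iff]
    refine ⟨hp.isPath, ?_⟩
    intro he
    have hz := hp.mem_support z
    cases p with
    | nil => exact hadj.ne rfl
    | @cons _ w _ h q =>
      have hpath := hp.isPath
      rw [SimpleGraph.Walk.cons_isPath_iff] at hpath
      rw [SimpleGraph.Walk.edges_cons, List.mem_cons] at he
      rcases he with he | he
      · have hwy : y = w := by
          rcases Sym2.eq_iff.1 he with ⟨h1, _⟩ | ⟨h1, _⟩
          · exact absurd h1 hadj.ne
          · exact h1
        subst hwy
        have := SimpleGraph.Walk.nil_iff_eq_nil.1 (SimpleGraph.Walk.isPath_iff_nil.1 hpath.1)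
        subst this
        simp [hzx, hzy] at hz
      · exact hpath.2 (q.snd_mem_support_of_mem_edges he)
  · intro a
    simpa using hp a

end constr
/-- Let `G` be obtained from `C_n □ K_2` by TF-inflations at vertices of
exactly two distinct pillars not belonging to a common quadrangle (i.e. with non-consecutive
indices).  Then `G` is hamiltonian iff `n` is even, and for odd `n`, `G` has a hamiltonian
path. -/
theorem stmt12 (n : ℕ) (hn : 3 ≤ n) (S : Finset (PV n)) (orient : PV n → Bool)
    (i j : ZMod n) (hij : i ≠ j) (h1 : j ≠ i + 1) (h2 : i ≠ j + 1)
    (hpil : inflatedPillars S = {i, j}) :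
    ((∃ (x : InflV n S) (C : (inflPrism n S orient).Walk x x), C.IsHamiltonianCycle) ↔
        Even n) ∧
    (Odd n → ∃ (x y : InflV n S) (p : (inflPrism n S orient).Walk x y), p.IsHamiltonian) := by
  refine ⟨⟨?_, ?_⟩, ?_⟩
  · rintro ⟨x, C, hC⟩
    exact ham_even C hn hC i j hij h1 h2 hpil
  · intro he
    obtain ⟨l, hl⟩ := zig_full (S := S) (orient := orient) hn
    obtain ⟨p, hp⟩ := walk_of_PL hl
    have hs : sd n = false := by
      have := Nat.even_iff.1 he
      simp [sd, this]
    have hadj : (inflPrism n S orient).Adj (liftV S orient (-1, sd n) (0, sd n))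
        (liftV S orient (0, false) (-1, false)) := by
      rw [hs]
      exact lift_adj ((prism_adj_iff hn _ _).2 (Or.inr (Or.inl (by simp))))
    refine ⟨_, _, cycle_of_path p hp hadj (z := liftV S orient (0, true) (0, true)) ?_ ?_⟩
    · intro h
      have := congrArg (fun z : InflV n S => z.val.1.2) h
      simp [liftV] at this
    · intro h
      have := congrArg (fun z : InflV n S => z.val.1.2) h
      rw [hs] at this
      simp [liftV] at this
  · intro _
    obtain ⟨l, hl⟩ := zig_full (S := S) (orient := orient) hn
    obtain ⟨p, hp⟩ := walk_of_PL hl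
    exact ⟨_, _, p, hp⟩
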